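/- arXiv:1301.4923 — 7 statements merged into one kernel-verified Lean document; each statement's English description precedes it below -/
import Mathlib

section
/- Let L > 0 and let w ∈ ℂ with w ≠ 0 and sin(2Lw) ≠ 0, and set z := w². Then for every twice continuously differentiable function φ : [−L,L] → ℂ and every x ∈ [−L,L]: ∫_{−L}^{L} R(z;x,y) (z φ(y) + φ''(y)) dy = φ(x) − [ sin(w(x+L)) φ(L) − sin(w(x−L)) φ(−L) ] / sin(2wL). -/
open Set in
/-- Green identity on a subinterval for `d²/dy² + w²` tested against a translated sine. -/
theorem intervalIntegrable_and_integral_sin_mul_helmholtz {A B a b : ℝ} (hA : A ≤ a) (hab : a ≤ b)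
    (hB : b ≤ B) (hAB : A < B) (w c : ℂ) {φ : ℝ → ℂ} (hφ : ContDiffOn ℝ 2 φ (Icc A B)) :
    IntervalIntegrable (fun y : ℝ => Complex.sin (w * (y + c)) *
      (w ^ 2 * φ y + iteratedDerivWithin 2 φ (Icc A B) y)) MeasureTheory.volume a b ∧
    ∫ y in a..b, Complex.sin (w * (y + c)) *
        (w ^ 2 * φ y + iteratedDerivWithin 2 φ (Icc A B) y) =
      (Complex.sin (w * (b + c)) * derivWithin φ (Icc A B) b - w * Complex.cos (w * (b + c)) * φ b)
      - (Complex.sin (w * (a + c)) * derivWithin φ (Icc A B) a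
        - w * Complex.cos (w * (a + c)) * φ a) := by
  have hs : UniqueDiffOn ℝ (Icc A B) := uniqueDiffOn_Icc hAB
  have hsub : Icc a b ⊆ Icc A B := Icc_subset_Icc hA hB
  have hφc : ContinuousOn φ (Icc a b) := hφ.continuousOn.mono hsub
  have hφ2 : ContinuousOn (iteratedDerivWithin 2 φ (Icc A B)) (Icc a b) :=
    (hφ.continuousOn_iteratedDerivWithin le_rfl hs).mono hsub
  have hd : DifferentiableOn ℝ (derivWithin φ (Icc A B)) (Icc A B) := by
    have := hφ.differentiableOn_iteratedDerivWithin (m := 1) (by norm_num) hs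
    rwa [iteratedDerivWithin_one] at this
  have hint : IntervalIntegrable (fun y : ℝ => Complex.sin (w * (y + c)) *
      (w ^ 2 * φ y + iteratedDerivWithin 2 φ (Icc A B) y)) MeasureTheory.volume a b := by
    apply ContinuousOn.intervalIntegrable
    rw [uIcc_of_le hab]
    fun_prop
  refine ⟨hint, ?_⟩
  refine intervalIntegral.integral_eq_sub_of_hasDerivAt_of_le (f := fun y : ℝ =>
    Complex.sin (w * (y + c)) * derivWithin φ (Icc A B) y - w * Complex.cos (w * (y + c)) * φ y)
    hab ?_ ?_ hint
  · have := hd.continuousOn.mono hsub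
    fun_prop
  · intro y hy
    have hyn : Icc A B ∈ nhds y := Icc_mem_nhds (hA.trans_lt hy.1) (hy.2.trans_le hB)
    have hyI : y ∈ Icc A B := mem_of_mem_nhds hyn
    have h1 : HasDerivAt φ (derivWithin φ (Icc A B) y) y :=
      ((hφ.differentiableOn (by norm_num)) y hyI).hasDerivWithinAt.hasDerivAt hyn
    have h2 : HasDerivAt (derivWithin φ (Icc A B)) (iteratedDerivWithin 2 φ (Icc A B) y) y := by
      rw [iteratedDerivWithin_succ, iteratedDerivWithin_one]
      exact (hd y hyI).hasDerivWithinAt.hasDerivAt hyn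
    have hlin : HasDerivAt (fun y : ℂ => w * (y + c)) w y := by
      simpa using ((hasDerivAt_id (y : ℂ)).add_const c).const_mul w
    have h3 := (hlin.csin.comp_ofReal.mul h2).sub ((hlin.ccos.const_mul w).comp_ofReal.mul h1)
    refine h3.congr_deriv ?_
    ring

/-- Action of the free Dirichlet resolvent on `(z + d²/dy²)φ` for a `C²` function `φ`
on `[-L,L]`: the boundary values of `φ` appear explicitly. -/
theorem resolvent_boundary_identity (L : ℝ) (hL : 0 < L) (w : ℂ) (hw : w ≠ 0)
    (hsin : Complex.sin (2 * (L : ℂ) * w) ≠ 0)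
    (φ : ℝ → ℂ) (hφ : ContDiffOn ℝ 2 φ (Set.Icc (-L) L))
    (x : ℝ) (hx : x ∈ Set.Icc (-L) L) :
    letI z : ℂ := w^2
    letI R : ℝ → ℝ → ℂ := fun x y =>
      if y ≤ x then
        Complex.sin (w * ((x : ℂ) - (L : ℂ))) * Complex.sin (w * ((y : ℂ) + (L : ℂ))) /
          (w * Complex.sin (2 * (L : ℂ) * w))
      else
        Complex.sin (w * ((y : ℂ) - (L : ℂ))) * Complex.sin (w * ((x : ℂ) + (L : ℂ))) /
          (w * Complex.sin (2 * (L : ℂ) * w))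
    (∫ y in (-L)..L, R x y * (z * φ y + iteratedDerivWithin 2 φ (Set.Icc (-L) L) y))
      = φ x - (Complex.sin (w * ((x : ℂ) + (L : ℂ))) * φ L
          - Complex.sin (w * ((x : ℂ) - (L : ℂ))) * φ (-L)) / Complex.sin (2 * w * (L : ℂ)) := by
  set R : ℝ → ℝ → ℂ := fun x y =>
      if y ≤ x then
        Complex.sin (w * ((x : ℂ) - (L : ℂ))) * Complex.sin (w * ((y : ℂ) + (L : ℂ))) /
          (w * Complex.sin (2 * (L : ℂ) * w))
      else
        Complex.sin (w * ((y : ℂ) - (L : ℂ))) * Complex.sin (w * ((x : ℂ) + (L : ℂ))) /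
          (w * Complex.sin (2 * (L : ℂ) * w)) with hR
  obtain ⟨hxl, hxr⟩ := hx
  have hLL : -L < L := by linarith
  obtain ⟨i1, e1⟩ := intervalIntegrable_and_integral_sin_mul_helmholtz le_rfl hxl hxr hLL w L hφ
  obtain ⟨i2, e2⟩ := intervalIntegrable_and_integral_sin_mul_helmholtz hxl hxr le_rfl hLL w (-L) hφ
  obtain ⟨D, hD⟩ : ∃ D, D = w * Complex.sin (2 * (L : ℂ) * w) := ⟨_, rfl⟩
  have c1 : Set.EqOn (fun y : ℝ => Complex.sin (w * ((x : ℂ) - L)) / D * (Complex.sin (w * (y + L)) *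
      (w ^ 2 * φ y + iteratedDerivWithin 2 φ (Set.Icc (-L) L) y)))
      (fun y => R x y * (w ^ 2 * φ y + iteratedDerivWithin 2 φ (Set.Icc (-L) L) y))
      (Set.uIcc (-L) x) := by
    intro y hy
    rw [Set.uIcc_of_le hxl] at hy
    simp only [hR, hD, if_pos hy.2]
    ring
  have c2 : Set.EqOn (fun y : ℝ => Complex.sin (w * ((x : ℂ) + L)) / D * (Complex.sin (w * (y + -L)) *
      (w ^ 2 * φ y + iteratedDerivWithin 2 φ (Set.Icc (-L) L) y)))
      (fun y => R x y * (w ^ 2 * φ y + iteratedDerivWithin 2 φ (Set.Icc (-L) L) y))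
      (Set.uIcc x L) := by
    intro y hy
    rw [Set.uIcc_of_le hxr] at hy
    rcases hy.1.eq_or_lt with rfl | h
    · simp only [hR, hD, le_refl, if_true]
      ring_nf
    · simp only [hR, hD, if_neg h.not_ge]
      ring_nf
  rw [← intervalIntegral.integral_add_adjacent_intervals
    ((i1.const_mul _).congr (c1.mono Set.uIoc_subset_uIcc))
    ((i2.const_mul _).congr (c2.mono Set.uIoc_subset_uIcc)),
    ← intervalIntegral.integral_congr c1, ← intervalIntegral.integral_congr c2,
    intervalIntegral.integral_const_mul, intervalIntegral.integral_const_mul, e1, e2]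
  have key : Complex.sin (2 * (L : ℂ) * w) =
      Complex.sin (w * (x + L)) * Complex.cos (w * (x + -L))
        - Complex.cos (w * (x + L)) * Complex.sin (w * (x + -L)) := by
    rw [← Complex.sin_sub]
    ring_nf
  have hcomm : 2 * w * (L : ℂ) = 2 * (L : ℂ) * w := by ring
  rw [hcomm, hD]
  simp only [Complex.ofReal_neg, neg_add_cancel, add_neg_cancel, mul_zero, Complex.sin_zero,
    Complex.cos_zero, sub_eq_add_neg (x : ℂ)]
  generalize Complex.sin (2 * (L : ℂ) * w) = S at *
  field_simp
  rw [key]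
  ring
end

section
/- Let H be a complex Hilbert space, A : H → H a continuous linear equivalence (bounded invertible operator), f₁, f₂, g₁, g₂ ∈ H, and a₁, a₂ ∈ ℂ. Suppose h₁, h₂ ∈ H satisfy (A − a₁⟨f₁,·⟩g₁ − a₂⟨f₂,·⟩g₂) h_k = g_k for k = 1, 2. Then the 2×2 complex matrices B̂ := (⟨f_j, h_k⟩)_{j,k=1,2}, Â := (⟨f_j, A^{−1} g_k⟩)_{j,k=1,2}, and â := diag(a₁, a₂) satisfy B̂ − Â â B̂ = Â. -/
open scoped InnerProductSpace

/-- Reduction lemma for a rank-two perturbation of an invertible operator: if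
`(A − a₁⟨f₁,·⟩g₁ − a₂⟨f₂,·⟩g₂) h_k = g_k` for `k = 1,2`, then the `2×2` matrices
`B̂ = (⟨f_j,h_k⟩)`, `Â = (⟨f_j,A⁻¹g_k⟩)`, `â = diag(a₁,a₂)` satisfy `B̂ − Â â B̂ = Â`. -/
theorem rank_two_reduction {H : Type*} [NormedAddCommGroup H] [InnerProductSpace ℂ H]
    (A : H ≃L[ℂ] H) (f g h : Fin 2 → H) (a : Fin 2 → ℂ)
    (hyp : ∀ k : Fin 2,
      A (h k) - (a 0 * ⟪f 0, h k⟫_ℂ) • g 0 - (a 1 * ⟪f 1, h k⟫_ℂ) • g 1 = g k) :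
    letI B : Matrix (Fin 2) (Fin 2) ℂ := Matrix.of fun j k => ⟪f j, h k⟫_ℂ
    letI Ahat : Matrix (Fin 2) (Fin 2) ℂ := Matrix.of fun j k => ⟪f j, A.symm (g k)⟫_ℂ
    B - Ahat * Matrix.diagonal a * B = Ahat := by
  ext j k
  have key := congrArg (fun x => ⟪f j, A.symm x⟫_ℂ) (hyp k)
  simp only [map_sub, map_smul, ContinuousLinearEquiv.symm_apply_apply, inner_sub_right,
    inner_smul_right] at key
  simp only [Matrix.sub_apply, Matrix.mul_apply (M := _ * _), Matrix.mul_diagonal, Matrix.of_apply,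
    Fin.sum_univ_two]
  linear_combination key
end

section
/- Let a < b be real numbers, E > 0, μ ∈ ℝ with μ ≤ E, and let V : [a,b] → ℝ be continuous. Suppose ψ : [a,b] → ℝ is twice continuously differentiable, not identically zero, satisfies ψ(a) = ψ(b) = 0 and ψ''(x) = (V(x) − μ) ψ(x) for all x ∈ [a,b]. Then π² ≤ (b−a)² (E + sup_{x∈[a,b]} max(−V(x), 0)). -/
open Set in
/-- **Picone comparison.** If `ψ'' = q ψ` on `[a, b]` with `ψ a = ψ b = 0`, where `-k ^ 2 ≤ q` and
`0 < k`, `k (b - a) < π`, then `ψ` vanishes identically on `[a, b]`. -/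
theorem eq_zero_of_dirichlet_of_mul_lt_pi {a b k : ℝ} (hab : a < b) (hk : 0 < k)
    (hkπ : k * (b - a) < Real.pi) {ψ p q : ℝ → ℝ}
    (hψc : ContinuousOn ψ (Icc a b)) (hpc : ContinuousOn p (Icc a b))
    (hψ : ∀ x ∈ Ioo a b, HasDerivAt ψ (p x) x)
    (hp : ∀ x ∈ Ioo a b, HasDerivAt p (q x * ψ x) x)
    (hq : ∀ x ∈ Ioo a b, -k ^ 2 ≤ q x) (ha : ψ a = 0) (hb : ψ b = 0) :
    ∀ x ∈ Icc a b, ψ x = 0 := by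
  set θ : ℝ → ℝ := fun x ↦ k * (x - (a + b) / 2) with hθ
  have hθd (x : ℝ) : HasDerivAt θ k x := by
    simpa using ((hasDerivAt_id x).sub_const ((a + b) / 2)).const_mul k
  have hcos : ∀ x ∈ Icc a b, 0 < Real.cos (θ x) := fun x hx ↦ by
    apply Real.cos_pos_of_mem_Ioo
    constructor <;> simp only [hθ] <;> nlinarith [hx.1, hx.2]
  set T : ℝ → ℝ := fun x ↦ k * Real.tan (θ x) with hT
  have hTd : ∀ x ∈ Icc a b, HasDerivAt T (k ^ 2 + T x ^ 2) x := fun x hx ↦ by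
    have hc := (hcos x hx).ne'
    refine (((Real.hasDerivAt_tan hc).comp x (hθd x)).const_mul k).congr_deriv ?_
    simp only [hT, Real.tan_eq_sin_div_cos]
    field_simp
    linear_combination -Real.sin_sq_add_cos_sq (θ x)
  have hTc : ContinuousOn T (Icc a b) := fun x hx ↦ (hTd x hx).continuousAt.continuousWithinAt
  set G : ℝ → ℝ := fun x ↦ ψ x * p x + ψ x ^ 2 * T x with hG
  have hGc : ContinuousOn G (Icc a b) := (hψc.mul hpc).add ((hψc.pow 2).mul hTc)
  have hGd : ∀ x ∈ Ioo a b,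
      HasDerivAt G ((p x + T x * ψ x) ^ 2 + (q x + k ^ 2) * ψ x ^ 2) x := fun x hx ↦ by
    refine (((hψ x hx).mul (hp x hx)).add
      (((hψ x hx).pow 2).mul (hTd x (Ioo_subset_Icc_self hx)))).congr_deriv ?_
    simp
    ring
  have hmono : MonotoneOn G (Icc a b) := by
    refine monotoneOn_of_deriv_nonneg (convex_Icc a b) hGc ?_ ?_ <;> rw [interior_Icc]
    · exact fun x hx ↦ (hGd x hx).differentiableAt.differentiableWithinAt
    · intro x hx
      rw [(hGd x hx).deriv]
      have : 0 ≤ q x + k ^ 2 := by linarith [hq x hx]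
      positivity
  have hG0 : ∀ x ∈ Icc a b, G x = 0 := fun x hx ↦ by
    have h1 := hmono (left_mem_Icc.2 hab.le) hx hx.1
    have h2 := hmono hx (right_mem_Icc.2 hab.le) hx.2
    have hGa : G a = 0 := by simp [hG, ha]
    have hGb : G b = 0 := by simp [hG, hb]
    linarith
  have hfirst : ∀ x ∈ Ioo a b, p x + T x * ψ x = 0 := fun x hx ↦ by
    have heq : G =ᶠ[nhds x] fun _ ↦ 0 := by
      filter_upwards [Icc_mem_nhds hx.1 hx.2] with y hy using hG0 y hy
    have hz := (hGd x hx).unique ((hasDerivAt_const x (0 : ℝ)).congr_of_eventuallyEq heq)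
    have h1 : 0 ≤ (q x + k ^ 2) * ψ x ^ 2 :=
      mul_nonneg (by linarith [hq x hx]) (sq_nonneg _)
    exact pow_eq_zero_iff two_ne_zero |>.1 (le_antisymm (by linarith) (sq_nonneg _))
  have hθc : Continuous θ := by fun_prop
  have huc : ContinuousOn (fun x ↦ ψ x / Real.cos (θ x)) (Icc a b) :=
    hψc.div (Real.continuous_cos.comp hθc).continuousOn fun x hx ↦ (hcos x hx).ne'
  have hud : ∀ x ∈ Ioo a b, HasDerivAt (fun x ↦ ψ x / Real.cos (θ x)) 0 x := fun x hx ↦ by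
    have hc := (hcos x (Ioo_subset_Icc_self hx)).ne'
    refine ((hψ x hx).div (hθd x).cos hc).congr_deriv ?_
    have h := hfirst x hx
    simp only [hT, Real.tan_eq_sin_div_cos] at h
    field_simp at h ⊢
    linear_combination h
  intro x hx
  rcases hx.1.eq_or_lt with rfl | hax
  · exact ha
  obtain ⟨c, hc, hcx⟩ := exists_hasDerivAt_eq_slope _ (fun _ ↦ (0 : ℝ)) hax
    (huc.mono (Icc_subset_Icc_right hx.2)) fun y hy ↦ hud y ⟨hy.1, hy.2.trans_le hx.2⟩
  have := hcos x hx
  simpa [ha, this.ne', (sub_pos.2 hax).ne'] using hcx.symm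

/-- Lower bound on the spacing of consecutive Dirichlet zeros: if `ψ` is a nontrivial
solution of `ψ'' = (V − μ)ψ` on `[a,b]` with `ψ(a) = ψ(b) = 0` and `μ ≤ E`, then
`π² ≤ (b−a)²(E + sup max(−V,0))`. -/
theorem zero_spacing_bound (a b : ℝ) (hab : a < b) (E : ℝ) (hE : 0 < E)
    (μ : ℝ) (hμ : μ ≤ E) (V : ℝ → ℝ) (hV : ContinuousOn V (Set.Icc a b))
    (ψ : ℝ → ℝ) (hψ : ContDiffOn ℝ 2 ψ (Set.Icc a b))
    (hne : ∃ x ∈ Set.Icc a b, ψ x ≠ 0)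
    (ha : ψ a = 0) (hb : ψ b = 0)
    (hode : ∀ x ∈ Set.Icc a b,
      iteratedDerivWithin 2 ψ (Set.Icc a b) x = (V x - μ) * ψ x) :
    Real.pi ^ 2 ≤ (b - a) ^ 2 * (E + ⨆ x : Set.Icc a b, max (-V x) 0) := by
  by_contra! hlt
  obtain ⟨x₀, hx₀, hne⟩ := hne
  set S := ⨆ x : Set.Icc a b, max (-V x) 0
  have hS : ∀ x ∈ Set.Icc a b, max (-V x) 0 ≤ S := by
    have hbdd : BddAbove (Set.range fun x : Set.Icc a b ↦ max (-V x) 0) :=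
      (isCompact_range (hV.domRestrict.neg.max continuous_const)).bddAbove
    exact fun x hx ↦ le_ciSup hbdd ⟨x, hx⟩
  have hK : 0 < E + S :=
    add_pos_of_pos_of_nonneg hE ((le_max_right _ _).trans (hS x₀ hx₀))
  have hu := uniqueDiffOn_Icc hab
  have hp : ContDiffOn ℝ 1 (derivWithin ψ (Set.Icc a b)) (Set.Icc a b) :=
    hψ.derivWithin hu (by norm_num)
  refine hne (eq_zero_of_dirichlet_of_mul_lt_pi (p := derivWithin ψ (Set.Icc a b))
    (q := fun x ↦ V x - μ) hab (Real.sqrt_pos.2 hK) ?_ hψ.continuousOn hp.continuousOn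
    (fun x hx ↦ ?_) (fun x hx ↦ ?_) (fun x hx ↦ ?_) ha hb x₀ hx₀)
  · refine lt_of_pow_lt_pow_left₀ 2 Real.pi_pos.le ?_
    rwa [mul_pow, Real.sq_sqrt hK.le, mul_comm]
  · have hx' := Set.Ioo_subset_Icc_self hx
    exact (hψ.differentiableOn two_ne_zero x hx').hasDerivWithinAt.hasDerivAt
      (Icc_mem_nhds hx.1 hx.2)
  · have hx' := Set.Ioo_subset_Icc_self hx
    rw [← hode x hx', iteratedDerivWithin_succ]
    simp only [iteratedDerivWithin_one]
    exact (hp.differentiableOn one_ne_zero x hx').hasDerivWithinAt.hasDerivAt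
      (Icc_mem_nhds hx.1 hx.2)
  · rw [Real.sq_sqrt hK.le]
    linarith [le_max_left (-V x) 0, hS x (Set.Ioo_subset_Icc_self hx)]
end

section
/- Let L > 0, E > 0, α > 0, C_α ≥ 0, and let V : ℝ → ℝ be bounded and continuous with max(−V(x), 0) ≤ C_α/(1+|x|)^{α+1} for all x ∈ ℝ. Suppose ψ : [−L,L] → ℝ is twice continuously differentiable, not identically zero, satisfies −ψ''(x) + V(x)ψ(x) = μψ(x) on [−L,L] with μ < E, and ψ has at least M+1 distinct zeros in [−L,L]. Then M ≤ (2L/π)√E + C_E, where C_E := (1/(2E)) [ (2C_α/(απ)) (‖V₋‖_∞ + E)^{1/2} + ‖V₋‖_∞ ] and ‖V₋‖_∞ := sup_{x∈ℝ} max(−V(x), 0). -/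
open Set Filter Topology

/-- A continuous function on `[a, b]` with nonnegative right derivatives satisfies `f a ≤ f b`. -/
theorem le_of_right_deriv_nonneg {f f' : ℝ → ℝ} {a b : ℝ} (hab : a ≤ b)
    (hf : ContinuousOn f (Icc a b))
    (hf' : ∀ x ∈ Ico a b, HasDerivWithinAt f (f' x) (Ici x) x)
    (h0 : ∀ x ∈ Ico a b, 0 ≤ f' x) : f a ≤ f b :=
  image_le_of_deriv_right_le_deriv_boundary (f := fun _ => f a) (f' := fun _ => 0)
    continuousOn_const (fun x _ => hasDerivWithinAt_const x _ _) le_rfl hf hf' h0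
    (right_mem_Icc.2 hab)

/-- Uniqueness for `ψ'' = -Qψ`: vanishing Cauchy data at one point force `ψ = 0`. -/
theorem eq_zero_of_cauchy_data_eq_zero {ψ φ Q : ℝ → ℝ} {A B K c : ℝ}
    (hψ : ∀ x ∈ Icc A B, HasDerivWithinAt ψ (φ x) (Icc A B) x)
    (hφ : ∀ x ∈ Icc A B, HasDerivWithinAt φ (-(Q x * ψ x)) (Icc A B) x)
    (hQ : ∀ x, |Q x| ≤ K) (hc : c ∈ Icc A B) (hψc : ψ c = 0) (hφc : φ c = 0) :
    ∀ x ∈ Icc A B, ψ x = 0 := by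
  have hK : 0 ≤ K := (abs_nonneg _).trans (hQ 0)
  set v : ℝ → ℝ × ℝ → ℝ × ℝ := fun t y => (y.2, -(Q t * y.1)) with hv
  have hlip : ∀ t, LipschitzOnWith (max 1 ⟨K, hK⟩) (v t) univ := by
    intro t
    refine LipschitzOnWith.of_dist_le_mul fun y _ z _ => ?_
    have e1 : dist (v t y).1 (v t z).1 = dist y.2 z.2 := rfl
    have e2 : dist (v t y).2 (v t z).2 = |Q t| * dist y.1 z.1 := by
      simp only [hv, Real.dist_eq, ← abs_mul]
      rw [← abs_neg]; congr 1; ring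
    have hy : dist y.1 z.1 ≤ dist y z := le_max_left _ _
    have hz : dist y.2 z.2 ≤ dist y z := le_max_right _ _
    have hc1 : (1 : ℝ) ≤ ((max 1 ⟨K, hK⟩ : NNReal) : ℝ) := by
      exact_mod_cast le_max_left (1 : NNReal) ⟨K, hK⟩
    have hc2 : K ≤ ((max 1 ⟨K, hK⟩ : NNReal) : ℝ) := by
      exact_mod_cast le_max_right (1 : NNReal) ⟨K, hK⟩
    rw [Prod.dist_eq, e1, e2]
    have hd : 0 ≤ dist y z := dist_nonneg
    refine max_le (hz.trans (by nlinarith)) ?_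
    exact mul_le_mul ((hQ t).trans hc2) hy dist_nonneg (by linarith)
  have hder : ∀ t ∈ Icc A B,
      HasDerivWithinAt (fun t => (ψ t, φ t)) (v t (ψ t, φ t)) (Icc A B) t :=
    fun t ht => (hψ t ht).prodMk (hφ t ht)
  have hcont : ContinuousOn (fun t => (ψ t, φ t)) (Icc A B) :=
    fun t ht => (hder t ht).continuousWithinAt
  have hv0 : ∀ t, v t 0 = 0 := fun t => by simp [hv]
  have key0 : (fun t => (ψ t, φ t)) c = (fun _ => (0 : ℝ × ℝ)) c := by simp [hψc, hφc]
  intro x hx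
  rcases le_total c x with h | h
  · have := ODE_solution_unique_of_mem_Icc_right (a := c) (b := B) (v := v)
      (s := fun _ => univ) (fun t _ => hlip t) (hcont.mono (Icc_subset_Icc_left hc.1))
      (fun t ht => (hder t ⟨hc.1.trans ht.1, ht.2.le⟩).mono_of_mem_nhdsWithin
        (mem_of_superset (Icc_mem_nhdsGE ht.2) (Icc_subset_Icc_left (hc.1.trans ht.1))))
      (fun _ _ => mem_univ _) continuousOn_const
      (fun t _ => by simpa [hv0] using hasDerivWithinAt_const t (Ici t) (0 : ℝ × ℝ))
      (fun _ _ => mem_univ _) key0 ⟨h, hx.2⟩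
    exact congrArg Prod.fst this
  · have := ODE_solution_unique_of_mem_Icc_left (a := A) (b := c) (v := v)
      (s := fun _ => univ) (fun t _ => hlip t) (hcont.mono (Icc_subset_Icc_right hc.2))
      (fun t ht => (hder t ⟨ht.1.le, ht.2.trans hc.2⟩).mono_of_mem_nhdsWithin
        (mem_of_superset (Icc_mem_nhdsLE ht.1) (Icc_subset_Icc_right (ht.2.trans hc.2))))
      (fun _ _ => mem_univ _) continuousOn_const
      (fun t _ => by simpa [hv0] using hasDerivWithinAt_const t (Iic t) (0 : ℝ × ℝ))
      (fun _ _ => mem_univ _) key0 ⟨hx.1, h⟩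
    exact congrArg Prod.fst this

/-- Near a simple zero `c` of `ψ`, the logarithmic derivative behaves like `1 / (x - c)`. -/
theorem tendsto_sub_mul_div_of_simple_zero {ψ φ : ℝ → ℝ} {s : Set ℝ} {c : ℝ}
    (hψ : HasDerivWithinAt ψ (φ c) s c) (hφ : ContinuousWithinAt φ s c)
    (h0 : ψ c = 0) (h1 : φ c ≠ 0) :
    Tendsto (fun x => (x - c) * (φ x / ψ x)) (𝓝[s \ {c}] c) (𝓝 1) := by
  have h := hasDerivWithinAt_iff_tendsto_slope.1 hψ
  have h2 : Tendsto φ (𝓝[s \ {c}] c) (𝓝 (φ c)) := hφ.mono sdiff_subset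
  have h3 := h2.div h h1
  rw [div_self h1] at h3
  refine h3.congr fun x => ?_
  simp only [Pi.div_apply, slope_def_field, h0, sub_zero]
  rw [div_div_eq_mul_div]; ring

/-- Prüfer-angle estimate: between two consecutive zeros of a solution of `ψ'' = -Qψ` with
`Q ≤ k²`, any `B` whose right derivative dominates `k + |k'| / (2 * k)` grows by at least `π`. -/
theorem pi_le_of_consecutive_zeros {ψ φ Q k k' B β : ℝ → ℝ} {a b : ℝ} (hab : a < b)
    (hψ : ∀ x ∈ Icc a b, HasDerivWithinAt ψ (φ x) (Icc a b) x)
    (hφ : ∀ x ∈ Icc a b, HasDerivWithinAt φ (-(Q x * ψ x)) (Icc a b) x)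
    (hψa : ψ a = 0) (hψb : ψ b = 0) (hφa : φ a ≠ 0) (hφb : φ b ≠ 0)
    (hne : ∀ x ∈ Ioo a b, ψ x ≠ 0)
    (hk : Continuous k) (hkpos : ∀ x, 0 < k x) (hQ : ∀ x, Q x ≤ k x ^ 2)
    (hk' : ∀ x, HasDerivWithinAt k (k' x) (Ici x) x)
    (hB : Continuous B) (hB' : ∀ x, HasDerivWithinAt B (β x) (Ici x) x)
    (hβ : ∀ x, k x + |k' x| / (2 * k x) ≤ β x) :
    Real.pi ≤ B b - B a := by
  set u : ℝ → ℝ := fun x => φ x / (k x * ψ x) with hu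
  set u' : ℝ → ℝ := fun x =>
    (-(Q x * ψ x) * (k x * ψ x) - φ x * (k' x * ψ x + k x * φ x)) / (k x * ψ x) ^ 2 with hu'
  have hu_d : ∀ x ∈ Ioo a b, HasDerivWithinAt u (u' x) (Ici x) x := by
    intro x hx
    have hn : Icc a b ∈ 𝓝 x := Icc_mem_nhds hx.1 hx.2
    have h1 := ((hψ x ⟨hx.1.le, hx.2.le⟩).hasDerivAt hn).hasDerivWithinAt (s := Ici x)
    have h2 := ((hφ x ⟨hx.1.le, hx.2.le⟩).hasDerivAt hn).hasDerivWithinAt (s := Ici x)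
    exact h2.div ((hk' x).mul h1) (mul_ne_zero (hkpos x).ne' (hne x hx))
  have hu_c : ContinuousOn u (Ioo a b) := by
    intro x hx
    have h1 : ContinuousWithinAt ψ (Ioo a b) x :=
      (hψ x ⟨hx.1.le, hx.2.le⟩).continuousWithinAt.mono Ioo_subset_Icc_self
    have h2 : ContinuousWithinAt φ (Ioo a b) x :=
      (hφ x ⟨hx.1.le, hx.2.le⟩).continuousWithinAt.mono Ioo_subset_Icc_self
    exact h2.div (hk.continuousWithinAt.mul h1) (mul_ne_zero (hkpos x).ne' (hne x hx))
  have hbound : ∀ x ∈ Ioo a b, 0 ≤ 1 / (1 + u x ^ 2) * u' x + β x := by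
    intro x hx
    have hψ0 := hne x hx
    have hk0 := hkpos x
    set D := (k x * ψ x) ^ 2 + φ x ^ 2 with hD
    have hDpos : 0 < D := by positivity
    have e : 1 / (1 + u x ^ 2) * u' x =
        (-(Q x * ψ x) * (k x * ψ x) - φ x * (k' x * ψ x + k x * φ x)) / D := by
      simp only [hu, hu', hD]
      field_simp
    have h1 : |φ x * ψ x| ≤ D / (2 * k x) := by
      rw [le_div_iff₀ (by positivity), abs_mul]
      have := sq_nonneg (k x * |ψ x| - |φ x|)
      simp only [hD]
      linear_combination this + k x ^ 2 * sq_abs (ψ x) + sq_abs (φ x)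
    have h2 : φ x * ψ x * k' x ≤ D / (2 * k x) * |k' x| :=
      (le_abs_self _).trans (by rw [abs_mul]; gcongr)
    have h3 : (k x + |k' x| / (2 * k x)) * D ≤ β x * D :=
      mul_le_mul_of_nonneg_right (hβ x) hDpos.le
    have h4 : Q x * (k x * ψ x ^ 2) ≤ k x ^ 2 * (k x * ψ x ^ 2) :=
      mul_le_mul_of_nonneg_right (hQ x) (by positivity)
    have h5 : |k' x| / (2 * k x) * D = D / (2 * k x) * |k' x| := by ring
    rw [e, ← sub_neg_eq_add, sub_nonneg, le_div_iff₀ hDpos]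
    nlinarith
  have hmono : ∀ x y, a < x → x ≤ y → y < b →
      Real.arctan (u x) + B x ≤ Real.arctan (u y) + B y := by
    intro x y hx hxy hy
    refine le_of_right_deriv_nonneg (f := fun z => Real.arctan (u z) + B z)
      (f' := fun z => 1 / (1 + u z ^ 2) * u' z + β z) hxy ?_ ?_ ?_
    · exact (Real.continuous_arctan.comp_continuousOn
        (hu_c.mono fun z hz => ⟨hx.trans_le hz.1, hz.2.trans_lt hy⟩)).add hB.continuousOn
    · intro z hz
      exact (hu_d z ⟨hx.trans_le hz.1, hz.2.trans hy⟩).arctan.add (hB' z)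
    · exact fun z hz => hbound z ⟨hx.trans_le hz.1, hz.2.trans hy⟩
  have hua : Tendsto u (𝓝[>] a) atTop := by
    have ha := left_mem_Icc.2 hab.le
    have h := tendsto_sub_mul_div_of_simple_zero (hψ a ha) (hφ a ha).continuousWithinAt hψa hφa
    rw [Icc_sdiff_left, nhdsWithin_Ioc_eq_nhdsGT hab] at h
    have h1 : Tendsto (fun x => (x - a)⁻¹) (𝓝[>] a) atTop := by
      refine tendsto_inv_nhdsGT_zero.comp (tendsto_nhdsWithin_iff.2 ⟨?_, ?_⟩)
      · have : Tendsto (fun x => x - a) (𝓝 a) (𝓝 (a - a)) := (continuous_id.sub continuous_const).tendsto a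
        simpa using this.mono_left nhdsWithin_le_nhds
      · filter_upwards [self_mem_nhdsWithin] with x hx using sub_pos.2 (mem_Ioi.1 hx)
    have h2 : Tendsto (fun x => (k x)⁻¹) (𝓝[>] a) (𝓝 (k a)⁻¹) :=
      ((hk.tendsto a).inv₀ (hkpos a).ne').mono_left nhdsWithin_le_nhds
    have h3 := h1.atTop_mul_pos (C := 1 * (k a)⁻¹) (by simpa using hkpos a) (h.mul h2)
    refine h3.congr' ?_
    filter_upwards [self_mem_nhdsWithin] with x hx
    have : x - a ≠ 0 := (sub_pos.2 (mem_Ioi.1 hx)).ne'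
    rw [← mul_assoc, ← mul_assoc, inv_mul_cancel₀ this]
    simp only [hu, one_mul]; rw [div_mul_eq_div_div_swap]; rfl
  have hub : Tendsto u (𝓝[<] b) atBot := by
    have hb := right_mem_Icc.2 hab.le
    have h := tendsto_sub_mul_div_of_simple_zero (hψ b hb) (hφ b hb).continuousWithinAt hψb hφb
    rw [Icc_sdiff_right, nhdsWithin_Ico_eq_nhdsLT hab] at h
    have h1 : Tendsto (fun x => (x - b)⁻¹) (𝓝[<] b) atBot := by
      refine tendsto_inv_nhdsLT_zero.comp (tendsto_nhdsWithin_iff.2 ⟨?_, ?_⟩)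
      · have : Tendsto (fun x => x - b) (𝓝 b) (𝓝 (b - b)) := (continuous_id.sub continuous_const).tendsto b
        simpa using this.mono_left nhdsWithin_le_nhds
      · filter_upwards [self_mem_nhdsWithin] with x hx using sub_neg.2 (mem_Iio.1 hx)
    have h2 : Tendsto (fun x => (k x)⁻¹) (𝓝[<] b) (𝓝 (k b)⁻¹) :=
      ((hk.tendsto b).inv₀ (hkpos b).ne').mono_left nhdsWithin_le_nhds
    have h3 := h1.atBot_mul_pos (C := 1 * (k b)⁻¹) (by simpa using hkpos b) (h.mul h2)
    refine h3.congr' ?_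
    filter_upwards [self_mem_nhdsWithin] with x hx
    have : x - b ≠ 0 := (sub_neg.2 (mem_Iio.1 hx)).ne
    rw [← mul_assoc, ← mul_assoc, inv_mul_cancel₀ this]
    simp only [hu, one_mul]; rw [div_mul_eq_div_div_swap]; rfl
  have hla : Tendsto (fun x => Real.arctan (u x) + B x) (𝓝[>] a) (𝓝 (Real.pi / 2 + B a)) :=
    ((tendsto_nhds_of_tendsto_nhdsWithin Real.tendsto_arctan_atTop).comp hua).add
      ((hB.tendsto a).mono_left nhdsWithin_le_nhds)
  have hlb : Tendsto (fun x => Real.arctan (u x) + B x) (𝓝[<] b) (𝓝 (-(Real.pi / 2) + B b)) :=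
    ((tendsto_nhds_of_tendsto_nhdsWithin Real.tendsto_arctan_atBot).comp hub).add
      ((hB.tendsto b).mono_left nhdsWithin_le_nhds)
  have hmid : ∀ y ∈ Ioo a b, Real.pi / 2 + B a ≤ Real.arctan (u y) + B y := by
    intro y hy
    refine le_of_tendsto hla ?_
    filter_upwards [Ioo_mem_nhdsGT hy.1] with x hx using hmono x y hx.1 hx.2.le hy.2
  have hfin : Real.pi / 2 + B a ≤ -(Real.pi / 2) + B b := by
    refine ge_of_tendsto hlb ?_
    filter_upwards [Ioo_mem_nhdsLT hab] with y hy using hmid y hy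
  linarith

/-- `pi_le_of_consecutive_zeros` for two arbitrary zeros of a nontrivial solution. -/
theorem pi_le_of_zeros {ψ φ Q k k' B β : ℝ → ℝ} {A D K s t : ℝ}
    (hψ : ∀ x ∈ Icc A D, HasDerivWithinAt ψ (φ x) (Icc A D) x)
    (hφ : ∀ x ∈ Icc A D, HasDerivWithinAt φ (-(Q x * ψ x)) (Icc A D) x)
    (hQK : ∀ x, |Q x| ≤ K) (hne : ∃ x ∈ Icc A D, ψ x ≠ 0)
    (hk : Continuous k) (hkpos : ∀ x, 0 < k x) (hQ : ∀ x, Q x ≤ k x ^ 2)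
    (hk' : ∀ x, HasDerivWithinAt k (k' x) (Ici x) x)
    (hB : Continuous B) (hB' : ∀ x, HasDerivWithinAt B (β x) (Ici x) x)
    (hβ : ∀ x, k x + |k' x| / (2 * k x) ≤ β x) (hBm : Monotone B)
    (hs : s ∈ Icc A D) (ht : t ∈ Icc A D) (hst : s < t) (hψs : ψ s = 0) (hψt : ψ t = 0) :
    Real.pi ≤ B t - B s := by
  have hsimple : ∀ x ∈ Icc A D, ψ x = 0 → φ x ≠ 0 := by
    intro x hx h0 h1
    obtain ⟨y, hy, hy0⟩ := hne
    exact hy0 (eq_zero_of_cauchy_data_eq_zero hψ hφ hQK hx h0 h1 y hy)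
  have hsub : Icc s t ⊆ Icc A D := Icc_subset_Icc hs.1 ht.2
  have hev : ∀ᶠ x in 𝓝[>] s, ψ x ≠ 0 := by
    have h := ((hψ s hs).mono hsub).eventually_ne (hsimple s hs hψs) (c := 0)
    rwa [Icc_sdiff_left, nhdsWithin_Ioc_eq_nhdsGT hst] at h
  obtain ⟨r, hr, hrne⟩ := (mem_nhdsGT_iff_exists_Ioo_subset' hst).1 hev
  have hr : s < r := hr
  have hcont : ContinuousOn ψ (Icc s t) :=
    fun x hx => ((hψ x (hsub hx)).mono hsub).continuousWithinAt
  have hrt : r ≤ t := by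
    by_contra! h
    exact hrne ⟨hst, h⟩ hψt
  have hcpt : IsCompact (Icc r t ∩ ψ ⁻¹' {0}) :=
    isCompact_Icc.of_isClosed_subset
      ((hcont.mono (Icc_subset_Icc_left hr.le)).preimage_isClosed_of_isClosed isClosed_Icc
        isClosed_singleton) inter_subset_left
  obtain ⟨b, ⟨hb, hb0⟩, hmin⟩ := hcpt.exists_isLeast ⟨t, ⟨hrt, le_rfl⟩, hψt⟩
  have hsb : s < b := hr.trans_le hb.1
  have hsub' : Icc s b ⊆ Icc A D := Icc_subset_Icc hs.1 (hb.2.trans ht.2)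
  have h := pi_le_of_consecutive_zeros hsb
    (fun x hx => (hψ x (hsub' hx)).mono hsub') (fun x hx => (hφ x (hsub' hx)).mono hsub')
    hψs hb0 (hsimple s hs hψs) (hsimple b (hsub' (right_mem_Icc.2 hsb.le)) hb0)
    (fun x hx h0 => ?_) hk hkpos hQ hk' hB hB' hβ
  · linarith [hBm hb.2]
  · rcases lt_or_ge x r with h1 | h1
    · exact hrne ⟨hx.1, h1⟩ h0
    · exact (hmin ⟨⟨h1, hx.2.le.trans hb.2⟩, h0⟩).not_gt hx.2

/-- If a monotone function grows by at least `c` between any two points of a finite set, it grows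
by at least `(#S - 1) * c` on any interval containing `S`. -/
theorem card_sub_one_mul_le {G : ℝ → ℝ} (hG : Monotone G) {A c : ℝ} (S : Finset ℝ)
    (hS : ∀ x ∈ S, ∀ y ∈ S, x < y → c ≤ G y - G x) (hA : ∀ x ∈ S, A ≤ x) (hne : S.Nonempty)
    {y : ℝ} (hy : ∀ x ∈ S, x ≤ y) : ((S.card : ℝ) - 1) * c ≤ G y - G A := by
  induction S using Finset.induction_on_max generalizing y with
  | empty => simp at hne
  | insert a S ha ih =>
    have haS : a ∉ S := fun h => (ha a h).false
    have hay : a ≤ y := hy a (Finset.mem_insert_self a S)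
    have hAa : A ≤ a := hA a (Finset.mem_insert_self a S)
    rw [Finset.card_insert_of_notMem haS]
    rcases S.eq_empty_or_nonempty with rfl | hS0
    · simpa using hG (hAa.trans hay)
    · set m := S.max' hS0
      have hm : m ∈ S := S.max'_mem hS0
      have h1 := ih (fun x hx z hz => hS x (Finset.mem_insert_of_mem hx) z
        (Finset.mem_insert_of_mem hz)) (fun x hx => hA x (Finset.mem_insert_of_mem hx)) hS0
        (y := m) (fun x hx => S.le_max' x hx)
      have h2 := hS m (Finset.mem_insert_of_mem hm) a (Finset.mem_insert_self a S) (ha m hm)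
      have h3 := hG hay
      push_cast
      linarith

/-- Counting bound for a majorant `E + W` with `W` increasing on `(-∞, 0)` and decreasing on
`[0, ∞)`. -/
theorem card_sub_one_mul_pi_le {ψ φ Q W W' : ℝ → ℝ} {L E K v : ℝ} (hL : 0 < L) (hE : 0 < E)
    (hψ : ∀ x ∈ Icc (-L) L, HasDerivWithinAt ψ (φ x) (Icc (-L) L) x)
    (hφ : ∀ x ∈ Icc (-L) L, HasDerivWithinAt φ (-(Q x * ψ x)) (Icc (-L) L) x)
    (hQK : ∀ x, |Q x| ≤ K) (hne : ∃ x ∈ Icc (-L) L, ψ x ≠ 0)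
    (hW : Continuous W) (hW0 : ∀ x, 0 ≤ W x) (hWv : ∀ x, W x ≤ v) (hQ : ∀ x, Q x ≤ E + W x)
    (hW' : ∀ x, HasDerivWithinAt W (W' x) (Ici x) x)
    (hneg : ∀ x < 0, 0 ≤ W' x) (hpos : ∀ x, 0 ≤ x → W' x ≤ 0)
    (S : Finset ℝ) (hS0 : S.Nonempty) (hS : ∀ x ∈ S, x ∈ Icc (-L) L ∧ ψ x = 0) :
    ((S.card : ℝ) - 1) * Real.pi ≤
      2 * L * √E + (∫ x in (-L)..L, W x) / (2 * √E) + v / (2 * E) := by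
  have hqpos : ∀ x, 0 < E + W x := fun x => add_pos_of_pos_of_nonneg hE (hW0 x)
  have hsE : 0 < √E := Real.sqrt_pos.2 hE
  set k : ℝ → ℝ := fun x => √(E + W x) with hk
  have hkpos : ∀ x, 0 < k x := fun x => Real.sqrt_pos.2 (hqpos x)
  have hk2 : ∀ x, k x ^ 2 = E + W x := fun x => Real.sq_sqrt (hqpos x).le
  have hkc : Continuous k := (continuous_const.add hW).sqrt
  set R : ℝ → ℝ := fun x => Real.log (E + W x) / 4 with hR
  set G : ℝ → ℝ := fun x => √E * x + (∫ y in (0 : ℝ)..x, W y) / (2 * √E) +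
    (R (min x 0) - R (max x 0)) with hG
  set β : ℝ → ℝ := fun x => √E * 1 + W x / (2 * √E) + |W' x| / (4 * (E + W x)) with hβ
  have hq' : ∀ x, HasDerivWithinAt (fun x => E + W x) (W' x) (Ici x) x :=
    fun x => (hW' x).const_add E
  have hRc : Continuous R :=
    ((continuous_const.add hW).log fun x => (hqpos x).ne').div_const 4
  have hR' : ∀ x, HasDerivWithinAt R (W' x / (E + W x) / 4) (Ici x) x :=
    fun x => ((hq' x).log (hqpos x).ne').div_const 4
  have hGc : Continuous G := by
    refine ((continuous_const.mul continuous_id).add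
      ((intervalIntegral.continuous_primitive (fun a b => hW.intervalIntegrable a b) 0).div_const
        _)).add ?_
    exact (hRc.comp (continuous_id.min continuous_const)).sub
      (hRc.comp (continuous_id.max continuous_const))
  have hP : ∀ x, HasDerivWithinAt (fun x => R (min x 0) - R (max x 0))
      (|W' x| / (4 * (E + W x))) (Ici x) x := by
    intro x
    rcases lt_or_ge x 0 with hx | hx
    · rw [abs_of_nonneg (hneg x hx)]
      have h := (hR' x).sub_const (R 0)
      have e : W' x / (E + W x) / 4 = W' x / (4 * (E + W x)) := by rw [div_div, mul_comm]
      rw [e] at h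
      refine h.congr_of_eventuallyEq ?_ (by rw [min_eq_left hx.le, max_eq_right hx.le])
      filter_upwards [nhdsWithin_le_nhds (Iio_mem_nhds hx)] with y hy
      rw [min_eq_left (mem_Iio.1 hy).le, max_eq_right (mem_Iio.1 hy).le]
    · rw [abs_of_nonpos (hpos x hx)]
      have h := (hR' x).const_sub (R 0)
      have e : -(W' x / (E + W x) / 4) = -W' x / (4 * (E + W x)) := by
        rw [div_div, mul_comm, neg_div]
      rw [e] at h
      refine h.congr (fun y hy => ?_) (by rw [min_eq_right hx, max_eq_left hx])
      rw [min_eq_right (hx.trans hy), max_eq_left (hx.trans hy)]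
  have hG' : ∀ x, HasDerivWithinAt G (β x) (Ici x) x := fun x =>
    (((hasDerivWithinAt_id x _).const_mul _).add
      ((hW.integral_hasStrictDerivAt 0 x).hasDerivAt.hasDerivWithinAt.div_const _)).add (hP x)
  have hβ0 : ∀ x, 0 ≤ β x := by
    intro x
    have := hqpos x
    have := hW0 x
    positivity
  have hGm : Monotone G := fun x y hxy =>
    le_of_right_deriv_nonneg hxy hGc.continuousOn (fun z _ => hG' z) fun z _ => hβ0 z
  have hkβ : ∀ x, k x + |W' x / (2 * k x)| / (2 * k x) ≤ β x := by
    intro x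
    have h1 : k x ≤ √E * 1 + W x / (2 * √E) := by
      refine Real.sqrt_le_iff.2 ⟨?_, ?_⟩
      · have := hW0 x
        positivity
      · have e : (√E * 1 + W x / (2 * √E)) ^ 2 = √E ^ 2 + W x + (W x / (2 * √E)) ^ 2 := by
          field_simp
          ring
        rw [e, Real.sq_sqrt hE.le]
        linarith [sq_nonneg (W x / (2 * √E))]
    have h2 : |W' x / (2 * k x)| / (2 * k x) = |W' x| / (4 * (E + W x)) := by
      rw [← hk2, abs_div, abs_of_pos (mul_pos two_pos (hkpos x)), div_div]
      congr 1
      ring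
    rw [h2]
    exact add_le_add_left h1 _
  have hcount := card_sub_one_mul_le hGm (A := -L) (c := Real.pi) S
    (fun s hs t ht hst => pi_le_of_zeros hψ hφ hQK hne hkc hkpos
      (fun x => by rw [hk2]; exact hQ x) (fun x => (hq' x).sqrt (hqpos x).ne') hGc hG' hkβ hGm
      (hS s hs).1 (hS t ht).1 hst (hS s hs).2 (hS t ht).2)
    (fun x hx => (hS x hx).1.1) hS0 (fun x hx => (hS x hx).1.2)
  have hint : ∫ x in (-L)..L, W x = (∫ y in (0 : ℝ)..L, W y) - ∫ y in (0 : ℝ)..(-L), W y :=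
    (intervalIntegral.integral_interval_sub_left (hW.intervalIntegrable _ _)
      (hW.intervalIntegrable _ _)).symm
  have hdiff : G L - G (-L) = 2 * L * √E + (∫ x in (-L)..L, W x) / (2 * √E) +
      (2 * R 0 - R L - R (-L)) := by
    simp only [hG, hint, min_eq_right hL.le, max_eq_left hL.le,
      min_eq_left (neg_nonpos.2 hL.le), max_eq_right (neg_nonpos.2 hL.le)]
    ring
  have hRlow : ∀ x, Real.log E / 4 ≤ R x := fun x => by
    have := Real.log_le_log hE (le_add_of_nonneg_right (hW0 x))
    simp only [hR]
    linarith
  have hR0 : R 0 ≤ Real.log E / 4 + v / (4 * E) := by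
    have h1 : Real.log ((E + W 0) / E) ≤ (E + W 0) / E - 1 :=
      Real.log_le_sub_one_of_pos (div_pos (hqpos 0) hE)
    rw [Real.log_div (hqpos 0).ne' hE.ne'] at h1
    have h2 : (E + W 0) / E - 1 = W 0 / E := by field_simp; ring
    have h3 : W 0 / E ≤ v / E := by gcongr; exact hWv 0
    have h4 : v / (4 * E) = v / E / 4 := by rw [div_div, mul_comm]
    simp only [hR]
    linarith
  have hv : v / (2 * E) = 2 * (v / (4 * E)) := by field_simp; ring
  rw [hdiff] at hcount
  linarith [hRlow L, hRlow (-L)]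

/-- The even function `min v (g |x|)`, for `g` decreasing and differentiable on `[0, ∞)`, has a
right derivative everywhere, nonnegative on `(-∞, 0)` and nonpositive on `[0, ∞)`. -/
theorem exists_right_deriv_min_comp_abs {g g' : ℝ → ℝ} {v : ℝ}
    (hg : ∀ x, 0 ≤ x → HasDerivAt g (g' x) x) (hg' : ∀ x, 0 ≤ x → g' x ≤ 0)
    (hanti : AntitoneOn g (Ici 0)) (x : ℝ) :
    ∃ d, HasDerivWithinAt (fun x => min v (g |x|)) d (Ici x) x ∧
      (x < 0 → 0 ≤ d) ∧ (0 ≤ x → d ≤ 0) := by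
  rcases lt_or_ge x 0 with hx | hx
  · have hnx : 0 ≤ -x := neg_nonneg.2 hx.le
    have hder : HasDerivAt (fun y => g (-y)) (-g' (-x)) x := by
      have h := (hg (-x) hnx).comp x (hasDerivAt_neg x)
      rw [mul_neg_one] at h
      exact h
    rcases le_or_gt v (g (-x)) with h | h
    · refine ⟨0, ?_, fun _ => le_rfl, fun _ => le_rfl⟩
      refine (hasDerivWithinAt_const x (Ici x) v).congr_of_eventuallyEq ?_
        (by rw [abs_of_neg hx, min_eq_left h])
      filter_upwards [nhdsWithin_le_nhds (Iio_mem_nhds hx), self_mem_nhdsWithin] with y hy hxy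
      rw [abs_of_neg hy, min_eq_left (h.trans (hanti (mem_Ici.2 (neg_nonneg.2 (mem_Iio.1 hy).le)) hnx
        (neg_le_neg hxy)))]
    · refine ⟨_, hder.hasDerivWithinAt.congr_of_eventuallyEq ?_
        (by rw [abs_of_neg hx, min_eq_right h.le]), fun _ => by linarith [hg' (-x) hnx],
        fun h0 => absurd hx h0.not_gt⟩
      filter_upwards [nhdsWithin_le_nhds (Iio_mem_nhds hx),
        nhdsWithin_le_nhds (hder.continuousAt.eventually_lt_const h)] with y hy hyv
      rw [abs_of_neg hy, min_eq_right hyv.le]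
  · rcases lt_or_ge v (g x) with h | h
    · refine ⟨0, ?_, fun _ => le_rfl, fun _ => le_rfl⟩
      refine (hasDerivWithinAt_const x (Ici x) v).congr_of_eventuallyEq ?_
        (by rw [abs_of_nonneg hx, min_eq_left h.le])
      filter_upwards [nhdsWithin_le_nhds ((hg x hx).continuousAt.eventually_const_lt h),
        self_mem_nhdsWithin] with y hyv hxy
      rw [abs_of_nonneg (hx.trans hxy), min_eq_left hyv.le]
    · refine ⟨_, (hg x hx).hasDerivWithinAt.congr (fun y hy => ?_)
        (by rw [abs_of_nonneg hx, min_eq_right h]), fun h0 => absurd hx h0.not_ge,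
        fun _ => hg' x hx⟩
      rw [abs_of_nonneg (hx.trans hy),
        min_eq_right ((hanti hx (hx.trans hy) hy).trans h)]

/-- A continuous even function dominated by `C (1 + |x|) ^ (-(α + 1))` has integral at most
`2 C / α` over `[-L, L]`. -/
theorem integral_le_of_even_of_le_rpow {W : ℝ → ℝ} {C α L : ℝ} (hL : 0 < L) (hα : 0 < α)
    (hC : 0 ≤ C) (hW : Continuous W) (heven : ∀ x, W (-x) = W x)
    (hle : ∀ x, 0 ≤ x → W x ≤ C * (1 + x) ^ (-(α + 1))) :
    ∫ x in (-L)..L, W x ≤ 2 * C / α := by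
  have hhalf : ∫ x in (-L)..0, W x = ∫ x in (0 : ℝ)..L, W x := by
    rw [← neg_zero (G := ℝ), ← intervalIntegral.integral_comp_neg, neg_zero]
    simp only [heven]
  have hder : ∀ x, 0 ≤ x → HasDerivAt (fun x => -(C / α) * (1 + x) ^ (-α) - ∫ y in (0 : ℝ)..x, W y)
      (C * (1 + x) ^ (-(α + 1)) - W x) x := by
    intro x hx
    have h1 := (((hasDerivAt_id x).const_add 1).rpow_const (p := -α)
      (Or.inl (by simp; linarith))).const_mul (-(C / α))
    have h2 := h1.sub (hW.integral_hasStrictDerivAt 0 x).hasDerivAt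
    have e : -(C / α) * (1 * -α * (1 + id x) ^ (-α - 1)) = C * (1 + x) ^ (-(α + 1)) := by
      rw [show -(α + 1) = -α - 1 by ring, id]
      field_simp
    rw [e] at h2
    exact h2
  have h := le_of_right_deriv_nonneg hL.le
    (fun x hx => (hder x hx.1).continuousAt.continuousWithinAt)
    (fun x hx => (hder x hx.1).hasDerivWithinAt) (fun x hx => sub_nonneg.2 (hle x hx.1))
  simp only [add_zero, Real.one_rpow, intervalIntegral.integral_same, sub_zero, mul_one] at h
  have hp : 0 ≤ C / α * (1 + L) ^ (-α) := by positivity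
  rw [← intervalIntegral.integral_add_adjacent_intervals (hW.intervalIntegrable (-L) 0)
    (hW.intervalIntegrable 0 L), hhalf]
  have e : 2 * C / α = C / α + C / α := by ring
  rw [e]
  linarith

/-- Bargmann-type counting bound: a nontrivial solution of `−ψ'' + Vψ = μψ` on `[-L,L]`
with `μ < E` and with at least `M+1` distinct zeros in `[-L,L]` forces
`M ≤ (2L/π)√E + C_E`. -/
theorem bargmann_counting_bound (L : ℝ) (hL : 0 < L) (E : ℝ) (hE : 0 < E)
    (α : ℝ) (hα : 0 < α) (Cα : ℝ) (hCα : 0 ≤ Cα)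
    (V : ℝ → ℝ) (hVc : Continuous V) (hVb : ∃ C, ∀ x : ℝ, |V x| ≤ C)
    (hVm : ∀ x : ℝ, max (-V x) 0 ≤ Cα / (1 + |x|) ^ (α + 1))
    (μ : ℝ) (hμ : μ < E)
    (ψ : ℝ → ℝ) (hψ : ContDiffOn ℝ 2 ψ (Set.Icc (-L) L))
    (hne : ∃ x ∈ Set.Icc (-L) L, ψ x ≠ 0)
    (hode : ∀ x ∈ Set.Icc (-L) L,
      -iteratedDerivWithin 2 ψ (Set.Icc (-L) L) x + V x * ψ x = μ * ψ x)
    (M : ℕ) (S : Finset ℝ) (hcard : S.card = M + 1)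
    (hS : ∀ x ∈ S, x ∈ Set.Icc (-L) L ∧ ψ x = 0) :
    (M : ℝ) ≤ (2*L/Real.pi) * Real.sqrt E +
      (1/(2*E)) * ((2*Cα/(α*Real.pi)) * Real.sqrt ((⨆ x : ℝ, max (-V x) 0) + E)
        + ⨆ x : ℝ, max (-V x) 0) := by
  obtain ⟨C, hC⟩ := hVb
  set v : ℝ := ⨆ x : ℝ, max (-V x) 0 with hv
  have hbdd : BddAbove (range fun x : ℝ => max (-V x) 0) :=
    ⟨C, by rintro _ ⟨x, rfl⟩; exact max_le ((neg_le_abs _).trans (hC x)) ((abs_nonneg _).trans (hC x))⟩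
  have hVv : ∀ x, max (-V x) 0 ≤ v := fun x => le_ciSup hbdd x
  have hv0 : 0 ≤ v := (le_max_right _ _).trans (hVv 0)
  set g : ℝ → ℝ := fun t => Cα * (1 + t) ^ (-(α + 1)) with hg
  have hgd : ∀ x, 0 ≤ x → HasDerivAt g (Cα * (1 * (-(α + 1)) * (1 + x) ^ (-(α + 1) - 1))) x :=
    fun x hx => (((hasDerivAt_id x).const_add 1).rpow_const
      (Or.inl (by simp; linarith))).const_mul Cα
  have hgd0 : ∀ x, 0 ≤ x → Cα * (1 * (-(α + 1)) * (1 + x) ^ (-(α + 1) - 1)) ≤ 0 := by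
    intro x hx
    have : 0 ≤ Cα * ((α + 1) * (1 + x) ^ (-(α + 1) - 1)) := by positivity
    linarith
  have hanti : AntitoneOn g (Ici 0) := by
    intro x hx y hy hxy
    have hx : 0 ≤ x := hx
    exact mul_le_mul_of_nonneg_left
      (Real.rpow_le_rpow_of_nonpos (by linarith) (by linarith) (by linarith)) hCα
  choose W' hW' hneg hpos using exists_right_deriv_min_comp_abs (v := v) hgd hgd0 hanti
  have hgc : Continuous fun x : ℝ => g |x| :=
    continuous_const.mul ((continuous_const.add continuous_abs).rpow_const
      fun x => Or.inl (add_pos_of_pos_of_nonneg one_pos (abs_nonneg x)).ne')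
  have hWc : Continuous fun x => min v (g |x|) := continuous_const.min hgc
  have hVW : ∀ x, max (-V x) 0 ≤ min v (g |x|) := fun x => by
    refine le_min (hVv x) ((hVm x).trans_eq ?_)
    simp only [hg]
    rw [Real.rpow_neg (by positivity), div_eq_mul_inv]
  have hUD : UniqueDiffOn ℝ (Icc (-L) L) := uniqueDiffOn_Icc (by linarith)
  set φ : ℝ → ℝ := derivWithin ψ (Icc (-L) L) with hφ
  have hψd : ∀ x ∈ Icc (-L) L, HasDerivWithinAt ψ (φ x) (Icc (-L) L) x :=
    fun x hx => (hψ.differentiableOn (by norm_num) x hx).hasDerivWithinAt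
  have hφd : ∀ x ∈ Icc (-L) L,
      HasDerivWithinAt φ (-((μ - V x) * ψ x)) (Icc (-L) L) x := by
    intro x hx
    have h1 : ContDiffOn ℝ 1 φ (Icc (-L) L) := hψ.derivWithin hUD (by norm_num)
    have h2 := (h1.differentiableOn (by norm_num) x hx).hasDerivWithinAt
    have h3 := hode x hx
    rw [iteratedDerivWithin_succ, iteratedDerivWithin_one] at h3
    have e : derivWithin φ (Icc (-L) L) x = -((μ - V x) * ψ x) := by linarith
    rwa [e] at h2
  have hcount := card_sub_one_mul_pi_le (Q := fun x => μ - V x) (K := |μ| + C) hL hE hψd hφd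
    (fun x => (abs_sub _ _).trans (by linarith [hC x])) hne hWc
    (fun x => (le_max_right _ _).trans (hVW x)) (fun x => min_le_left _ _)
    (fun x => by linarith [(le_max_left (-V x) 0).trans (hVW x)]) hW' hneg hpos S
    (Finset.card_pos.1 (by omega)) hS
  have hint := integral_le_of_even_of_le_rpow hL hα hCα hWc (fun x => by rw [abs_neg])
    (fun x hx => (min_le_right _ _).trans (by rw [abs_of_nonneg hx]))
  have hsE : 0 < √E := Real.sqrt_pos.2 hE
  have hpi := Real.pi_pos
  have h1 : (∫ x in (-L)..L, min v (g |x|)) / (2 * √E) ≤ 2 * Cα / α * (√(v + E) / (2 * E)) := by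
    have h2 : 1 / (2 * √E) ≤ √(v + E) / (2 * E) := by
      rw [div_le_div_iff₀ (by positivity) (by positivity)]
      have := Real.sqrt_le_sqrt (le_add_of_nonneg_left hv0 : E ≤ v + E)
      nlinarith [Real.mul_self_sqrt hE.le]
    rw [div_eq_mul_one_div]
    exact mul_le_mul hint h2 (by positivity) (by positivity)
  have h2 : v / (2 * E) ≤ v / (2 * E) * Real.pi :=
    le_mul_of_one_le_right (by positivity) (by linarith [Real.pi_gt_three])
  rw [hcard] at hcount
  push_cast at hcount
  have h3 : (M : ℝ) * Real.pi ≤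
      2 * L * √E + 2 * Cα / α * (√(v + E) / (2 * E)) + v / (2 * E) * Real.pi := by linarith
  refine (le_div_iff₀ hpi).2 h3 |>.trans_eq ?_
  field_simp
  ring
end

section
/- Let L > 0, let k be a positive integer, let V : ℝ → ℝ be continuous with V ≥ 0, and let μ > 0 satisfy μ ≥ (kπ/(2L))². Suppose ϑ : [−L,L] → ℝ is differentiable with ϑ(−L) = 0, ϑ(L) = kπ, and ϑ'(x) = √μ − (V(x)/√μ) sin²(ϑ(x)) for all x ∈ [−L,L]. Then √μ ≤ kπ/(2L) + (1/(kπ)) ∫_{−L}^{L} V(x) dx. -/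
/-- Prüfer-phase eigenvalue bound: if the modified Prüfer phase `ϑ` of a Dirichlet
eigenfunction with nonnegative potential `V` satisfies `ϑ(−L) = 0`, `ϑ(L) = kπ` and the
Prüfer ODE with `μ ≥ (kπ/(2L))²`, then `√μ ≤ kπ/(2L) + ‖V‖₁/(kπ)`. -/
theorem pruefer_eigenvalue_bound (L : ℝ) (hL : 0 < L) (k : ℕ) (hk : 0 < k)
    (V : ℝ → ℝ) (hVc : Continuous V) (hV0 : ∀ x : ℝ, 0 ≤ V x)
    (μ : ℝ) (hμ0 : 0 < μ) (hμ : ((k : ℝ) * Real.pi / (2*L))^2 ≤ μ)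
    (ϑ : ℝ → ℝ) (hbcl : ϑ (-L) = 0) (hbcr : ϑ L = k * Real.pi)
    (hode : ∀ x ∈ Set.Icc (-L) L,
      HasDerivWithinAt ϑ
        (Real.sqrt μ - (V x / Real.sqrt μ) * Real.sin (ϑ x) ^ 2) (Set.Icc (-L) L) x) :
    Real.sqrt μ ≤ (k : ℝ) * Real.pi / (2*L) + (1/((k : ℝ) * Real.pi)) * ∫ x in (-L)..L, V x := by
  have hs : 0 < Real.sqrt μ := Real.sqrt_pos.2 hμ0
  have hkπ : 0 < (k : ℝ) * Real.pi := mul_pos (Nat.cast_pos.2 hk) Real.pi_pos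
  have hlow : (k : ℝ) * Real.pi ≤ 2 * L * Real.sqrt μ := by
    have h : (k : ℝ) * Real.pi / (2 * L) ≤ Real.sqrt μ := Real.le_sqrt_of_sq_le hμ
    rwa [div_le_iff₀' (by positivity)] at h
  have hφ : Continuous fun x => Real.sqrt μ - V x / Real.sqrt μ := by fun_prop
  have hint : ∫ x in (-L)..L, (Real.sqrt μ - V x / Real.sqrt μ) ≤ ϑ L - ϑ (-L) := by
    refine intervalIntegral.integral_le_sub_of_hasDeriv_right_of_le (by linarith)
      (fun x hx => (hode x hx).continuousWithinAt)
      (fun x hx => ((hode x (Set.Ioo_subset_Icc_self hx)).hasDerivAt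
        (Icc_mem_nhds hx.1 hx.2)).hasDerivWithinAt)
      hφ.continuousOn.integrableOn_Icc fun x _ => ?_
    exact sub_le_sub_left
      (mul_le_of_le_one_right (div_nonneg (hV0 x) hs.le) (Real.sin_sq_le_one _)) _
  have hI : 0 ≤ ∫ x in (-L)..L, V x :=
    intervalIntegral.integral_nonneg (by linarith) fun x _ => hV0 x
  rw [intervalIntegral.integral_sub intervalIntegrable_const
    ((hVc.div_const _).intervalIntegrable _ _), intervalIntegral.integral_const,
    intervalIntegral.integral_div, hbcl, hbcr, smul_eq_mul] at hint
  set I := ∫ x in (-L)..L, V x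
  calc Real.sqrt μ ≤ (k * Real.pi + I / Real.sqrt μ) / (2 * L) := by
        rw [le_div_iff₀ (by positivity)]
        linarith
    _ = k * Real.pi / (2 * L) + I / (2 * L * Real.sqrt μ) := by
        field_simp
    _ ≤ k * Real.pi / (2 * L) + I / (k * Real.pi) := by
        gcongr
    _ = k * Real.pi / (2 * L) + (1 / (k * Real.pi)) * I := by
        rw [one_div_mul_eq_div]
end

section
/- Let M ∈ ℝ and w ∈ ℝ with w + 1/2 > |M|. Then ∫₀^∞ e^{−wt} sinh(Mt)/sinh(t/2) dt = M/((w+1/2)² − M²) + ln((w + 1/2 + M)/(w + 1/2 − M)) + 8M(w+1/2) ∫₀^∞ y / ( [ (w+1/2+M)² + y² ] [ (w+1/2−M)² + y² ] ) · 1/(e^{2πy} − 1) dy. -/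
open MeasureTheory Set Filter Topology

/-- Mittag-Leffler expansion of `1 / (1 - e⁻ᵗ)`. -/
theorem hasSum_binet_kernel {t : ℝ} (ht : 0 < t) :
    HasSum (fun n : ℕ => 2 * t / (t ^ 2 + (2 * Real.pi * (n + 1)) ^ 2))
      (1 / (1 - Real.exp (-t)) - 1 / 2 - 1 / t) := by
  have hpi := Real.pi_pos
  have hpiC : (Real.pi : ℂ) ≠ 0 := by exact_mod_cast hpi.ne'
  have htC : (t : ℂ) ≠ 0 := by exact_mod_cast ht.ne'
  set z : ℂ := Complex.I * t / (2 * Real.pi) with hz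
  have hz' : z = ((t / (2 * Real.pi) : ℝ) : ℂ) * Complex.I := by
    rw [hz]; push_cast; ring
  have him : z.im = t / (2 * Real.pi) := by
    rw [hz', Complex.im_ofReal_mul, Complex.I_im, mul_one]
  have hmem : z ∈ Complex.integerComplement := by
    rw [Complex.mem_integerComplement_iff]
    rintro ⟨n, hn⟩
    have h0 : z.im = 0 := by rw [← hn]; simp
    rw [him] at h0
    have : 0 < t / (2 * Real.pi) := by positivity
    linarith
  have hs := (summable_cotTerm hmem).hasSum
  have he : (1 : ℂ) - Complex.exp (-t) ≠ 0 := by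
    have : (1 : ℝ) - Real.exp (-t) ≠ 0 := by
      have : Real.exp (-t) < 1 := by rw [Real.exp_lt_one_iff]; linarith
      linarith
    exact_mod_cast this
  have hval : ∑' n : ℕ, cotTerm z n = Real.pi * Complex.cot (Real.pi * z) - 1 / z := by
    rw [cot_series_rep' hmem]
  rw [hval, Complex.cot_pi_eq_exp_ratio] at hs
  have hexp : 2 * (Real.pi : ℂ) * Complex.I * z = -t := by
    rw [hz]; field_simp; rw [Complex.I_sq]
  rw [hexp] at hs
  have hs2 := hs.mul_left (Complex.I / (2 * Real.pi))
  have hterm (n : ℕ) : Complex.I / (2 * Real.pi) * cotTerm z n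
      = ((2 * t / (t ^ 2 + (2 * Real.pi * (n + 1)) ^ 2) : ℝ) : ℂ) := by
    rw [cotTerm_identity hmem]
    have h3 : (t : ℂ) ^ 2 + (2 * Real.pi * (n + 1)) ^ 2 ≠ 0 := by
      have : t ^ 2 + (2 * Real.pi * (n + 1)) ^ 2 ≠ 0 := by positivity
      exact_mod_cast this
    have h4 : (z + (n + 1)) * (z - (n + 1))
        = -(((t : ℂ) ^ 2 + (2 * Real.pi * (n + 1)) ^ 2) / (4 * Real.pi ^ 2)) := by
      have h5 : (z + (n + 1)) * (z - (n + 1)) = z ^ 2 - (n + 1) ^ 2 := by ring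
      rw [h5, hz, div_pow, mul_pow, Complex.I_sq]
      field_simp
      ring
    rw [h4, hz]
    push_cast
    field_simp
    rw [Complex.I_sq]
    ring
  have hlim : Complex.I / (2 * Real.pi) * (Real.pi * ((Complex.exp (-t) + 1) /
      (Complex.I * (1 - Complex.exp (-t)))) - 1 / z)
      = ((1 / (1 - Real.exp (-t)) - 1 / 2 - 1 / t : ℝ) : ℂ) := by
    push_cast
    rw [hz]
    field_simp
    ring
  rw [hlim] at hs2
  simp_rw [hterm] at hs2
  exact Complex.hasSum_ofReal.1 hs2

theorem integrableOn_mul_exp_neg {p : ℝ} (hp : 0 < p) :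
    IntegrableOn (fun t : ℝ => t * Real.exp (-p * t)) (Ioi 0) := by
  simpa using integrableOn_rpow_mul_exp_neg_mul_rpow (p := 1) (s := 1) (b := p)
    (by norm_num) one_pos hp

theorem integrableOn_binet_term {p : ℝ} (hp : 0 < p) {c : ℝ} (hc : 0 < c) :
    IntegrableOn (fun t : ℝ => 2 * t / (t ^ 2 + c ^ 2) * Real.exp (-p * t)) (Ioi 0) := by
  refine ((integrableOn_mul_exp_neg hp).const_mul (2 / c ^ 2)).mono' ?_ ?_
  · exact Measurable.aestronglyMeasurable (by fun_prop)
  · filter_upwards [ae_restrict_mem measurableSet_Ioi] with t ht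
    have ht : 0 < t := ht
    rw [Real.norm_of_nonneg (by positivity)]
    have : 2 * t / (t ^ 2 + c ^ 2) ≤ 2 * t / c ^ 2 := by
      gcongr
      nlinarith
    calc _ ≤ 2 * t / c ^ 2 * Real.exp (-p * t) := by gcongr
      _ = _ := by ring

theorem integral_binet_term_le {p : ℝ} (hp : 0 < p) {c : ℝ} (hc : 0 < c) :
    ∫ t in Ioi (0 : ℝ), 2 * t / (t ^ 2 + c ^ 2) * Real.exp (-p * t)
      ≤ 2 / c ^ 2 * ∫ t in Ioi (0 : ℝ), t * Real.exp (-p * t) := by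
  rw [← integral_const_mul]
  refine setIntegral_mono_on (integrableOn_binet_term hp hc)
    ((integrableOn_mul_exp_neg hp).const_mul _) measurableSet_Ioi fun t ht => ?_
  have ht : 0 < t := ht
  have : 2 * t / (t ^ 2 + c ^ 2) ≤ 2 * t / c ^ 2 := by
    gcongr
    nlinarith
  calc _ ≤ 2 * t / c ^ 2 * Real.exp (-p * t) := by gcongr
    _ = _ := by ring

theorem binet_term_comp_mul {p : ℝ} (hp : 0 < p) {c : ℝ} (hc : 0 < c) {y : ℝ} :
    c / p * (2 * (c / p * y) / ((c / p * y) ^ 2 + c ^ 2) * Real.exp (-p * (c / p * y)))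
      = 2 * (y / (p ^ 2 + y ^ 2)) * Real.exp (-c * y) := by
  have h1 : -p * (c / p * y) = -c * y := by field_simp
  have h2 : (c / p * y) ^ 2 + c ^ 2 = (c / p) ^ 2 * (p ^ 2 + y ^ 2) := by field_simp; ring
  have h3 : p ^ 2 + y ^ 2 ≠ 0 := by positivity
  rw [h1, h2]
  field_simp

theorem integrableOn_binet_term_dual {p : ℝ} (hp : 0 < p) {c : ℝ} (hc : 0 < c) :
    IntegrableOn (fun y : ℝ => 2 * (y / (p ^ 2 + y ^ 2)) * Real.exp (-c * y)) (Ioi 0) := by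
  have h := (integrableOn_Ioi_comp_mul_left_iff
    (fun t : ℝ => 2 * t / (t ^ 2 + c ^ 2) * Real.exp (-p * t)) 0 (div_pos hc hp)).2
    (by rw [mul_zero]; exact integrableOn_binet_term hp hc)
  refine (h.const_mul (c / p)).congr (.of_forall fun y => ?_)
  exact binet_term_comp_mul hp hc

theorem integral_binet_term_dual {p : ℝ} (hp : 0 < p) {c : ℝ} (hc : 0 < c) :
    ∫ y in Ioi (0 : ℝ), 2 * (y / (p ^ 2 + y ^ 2)) * Real.exp (-c * y)
      = ∫ t in Ioi (0 : ℝ), 2 * t / (t ^ 2 + c ^ 2) * Real.exp (-p * t) := by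
  have h := integral_comp_mul_left_Ioi'
    (fun t : ℝ => 2 * t / (t ^ 2 + c ^ 2) * Real.exp (-p * t)) 0 (div_pos hc hp)
  rw [mul_zero, smul_eq_mul, ← integral_const_mul] at h
  rw [← h]
  exact integral_congr_ae (.of_forall fun y => (binet_term_comp_mul hp hc).symm)

theorem summable_two_div_two_pi_mul_sq :
    Summable fun n : ℕ => 2 / (2 * Real.pi * ((n : ℝ) + 1)) ^ 2 := by
  have h := ((summable_nat_add_iff 1).2
    (Real.summable_one_div_nat_pow.2 (by norm_num : 1 < 2))).mul_left (2 / (2 * Real.pi) ^ 2)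
  refine h.congr fun n => ?_
  push_cast
  rw [mul_pow _ ((n : ℝ) + 1), div_mul_div_comm, mul_one]

/-- Two integral representations of the Binet remainder `log p - 1 / (2 * p) - ψ(p)`, with `ψ` the
digamma function. -/
theorem integral_binet_kernel {p : ℝ} (hp : 0 < p) :
    ∫ t in Ioi (0 : ℝ), (1 / (1 - Real.exp (-t)) - 1 / 2 - 1 / t) * Real.exp (-p * t)
      = 2 * ∫ y in Ioi (0 : ℝ), y / (p ^ 2 + y ^ 2) * (1 / (Real.exp (2 * Real.pi * y) - 1)) := by
  have hpi := Real.pi_pos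
  have hc (n : ℕ) : 0 < 2 * Real.pi * ((n : ℝ) + 1) := by positivity
  have hsum : Summable fun n : ℕ => ∫ t in Ioi (0 : ℝ),
      2 * t / (t ^ 2 + (2 * Real.pi * (n + 1)) ^ 2) * Real.exp (-p * t) := by
    refine Summable.of_nonneg_of_le (fun n => ?_) (fun n => integral_binet_term_le hp (hc n))
      (summable_two_div_two_pi_mul_sq.mul_right _)
    refine setIntegral_nonneg measurableSet_Ioi fun t ht => ?_
    have ht : 0 < t := ht
    positivity
  have h1 := hasSum_integral_of_summable_integral_norm
    (fun n : ℕ => integrableOn_binet_term hp (hc n)) (by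
      refine hsum.congr fun n => ?_
      refine setIntegral_congr_fun measurableSet_Ioi fun t ht => ?_
      have ht : 0 < t := ht
      exact (Real.norm_of_nonneg (by positivity)).symm)
  have h2 := hasSum_integral_of_summable_integral_norm
    (fun n : ℕ => integrableOn_binet_term_dual hp (hc n)) (by
      refine hsum.congr fun n => ?_
      rw [← integral_binet_term_dual hp (hc n)]
      refine setIntegral_congr_fun measurableSet_Ioi fun t ht => ?_
      have ht : 0 < t := ht
      exact (Real.norm_of_nonneg (by positivity)).symm)
  simp_rw [integral_binet_term_dual hp (hc _)] at h2
  have h3 := h1.unique h2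
  rw [← integral_const_mul]
  convert h3 using 1
  · refine setIntegral_congr_fun measurableSet_Ioi fun t ht => ?_
    exact ((hasSum_binet_kernel ht).mul_right _).tsum_eq.symm
  · refine setIntegral_congr_fun measurableSet_Ioi fun y hy => ?_
    have hy : 0 < y := hy
    have hlt : Real.exp (-(2 * Real.pi * y)) < 1 := by
      rw [Real.exp_lt_one_iff]
      have : 0 < 2 * Real.pi * y := by positivity
      linarith
    have hg := (hasSum_geometric_of_lt_one (Real.exp_pos _).le hlt).mul_left
      (2 * (y / (p ^ 2 + y ^ 2)) * Real.exp (-(2 * Real.pi * y)))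
    have hterm (n : ℕ) : 2 * (y / (p ^ 2 + y ^ 2)) * Real.exp (-(2 * Real.pi * (n + 1)) * y)
        = 2 * (y / (p ^ 2 + y ^ 2)) * Real.exp (-(2 * Real.pi * y))
          * Real.exp (-(2 * Real.pi * y)) ^ n := by
      rw [← Real.exp_nat_mul, mul_assoc _ (Real.exp _), ← Real.exp_add]
      congr 2
      ring
    rw [tsum_congr hterm, hg.tsum_eq, Real.exp_neg]
    have he := Real.exp_pos (2 * Real.pi * y)
    have h4e : (Real.exp (2 * Real.pi * y))⁻¹ * (1 - (Real.exp (2 * Real.pi * y))⁻¹)⁻¹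
        = 1 / (Real.exp (2 * Real.pi * y) - 1) := by
      rw [← mul_inv, one_div, mul_sub, mul_inv_cancel₀ he.ne', mul_one]
    rw [mul_assoc (2 * (y / (p ^ 2 + y ^ 2))), h4e, mul_assoc 2 (y / (p ^ 2 + y ^ 2))]

theorem integrableOn_binet_kernel {p : ℝ} (hp : 0 < p) :
    IntegrableOn (fun t : ℝ => (1 / (1 - Real.exp (-t)) - 1 / 2 - 1 / t) * Real.exp (-p * t))
      (Ioi 0) := by
  refine ((integrableOn_mul_exp_neg hp).const_mul
    (∑' n : ℕ, 2 / (2 * Real.pi * ((n : ℝ) + 1)) ^ 2)).mono' ?_ ?_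
  · exact Measurable.aestronglyMeasurable (by fun_prop)
  · filter_upwards [ae_restrict_mem measurableSet_Ioi] with t ht
    have ht : 0 < t := ht
    have hpi := Real.pi_pos
    have hk := hasSum_binet_kernel ht
    have h0 : 0 ≤ 1 / (1 - Real.exp (-t)) - 1 / 2 - 1 / t := hk.nonneg fun n => by positivity
    have h1 : 1 / (1 - Real.exp (-t)) - 1 / 2 - 1 / t
        ≤ (∑' n : ℕ, 2 / (2 * Real.pi * ((n : ℝ) + 1)) ^ 2) * t := by
      refine hasSum_le (fun n => ?_) hk (summable_two_div_two_pi_mul_sq.hasSum.mul_right t)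
      rw [div_mul_eq_mul_div]
      gcongr
      nlinarith
    rw [Real.norm_of_nonneg (by positivity), ← mul_assoc]
    gcongr

theorem integrableOn_binet_kernel_dual {p : ℝ} (hp : 0 < p) :
    IntegrableOn (fun y : ℝ => y / (p ^ 2 + y ^ 2) * (1 / (Real.exp (2 * Real.pi * y) - 1)))
      (Ioi 0) := by
  have h : IntegrableOn (fun y : ℝ => (1 + (y / p) ^ 2)⁻¹) (Ioi 0) :=
    (integrable_inv_one_add_sq.comp_div hp.ne').integrableOn
  refine (h.const_mul (1 / (2 * Real.pi) * (1 / p ^ 2))).mono' ?_ ?_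
  · exact Measurable.aestronglyMeasurable (by fun_prop)
  · filter_upwards [ae_restrict_mem measurableSet_Ioi] with y hy
    have hy : 0 < y := hy
    have hpi := Real.pi_pos
    have hpy : 0 < 2 * Real.pi * y := by positivity
    have he : 2 * Real.pi * y ≤ Real.exp (2 * Real.pi * y) - 1 := by
      linarith [Real.add_one_le_exp (2 * Real.pi * y)]
    have he0 : 0 < Real.exp (2 * Real.pi * y) - 1 := hpy.trans_le he
    rw [Real.norm_of_nonneg (by positivity)]
    calc y / (p ^ 2 + y ^ 2) * (1 / (Real.exp (2 * Real.pi * y) - 1))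
        ≤ y / (p ^ 2 + y ^ 2) * (1 / (2 * Real.pi * y)) := by gcongr
      _ = _ := by field_simp

theorem integrableOn_inv_mul_exp_sub_exp {p q : ℝ} (hp : 0 < p) (hq : 0 < q) :
    IntegrableOn (fun t : ℝ => t⁻¹ * (Real.exp (-p * t) - Real.exp (-q * t))) (Ioi 0) := by
  refine (((integrableOn_exp_mul_Ioi (neg_lt_zero.2 hp) 0).add
    (integrableOn_exp_mul_Ioi (neg_lt_zero.2 hq) 0)).const_mul |q - p|).mono' ?_ ?_
  · exact Measurable.aestronglyMeasurable (by fun_prop)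
  · filter_upwards [ae_restrict_mem measurableSet_Ioi] with t ht
    have ht : 0 < t := ht
    have key (a b : ℝ) : Real.exp (-a * t) - Real.exp (-b * t)
        ≤ |b - a| * t * Real.exp (-a * t) := by
      have h1 : Real.exp (-b * t) = Real.exp (-a * t) * Real.exp (-((b - a) * t)) := by
        rw [← Real.exp_add]; congr 1; ring
      have h2 := Real.add_one_le_exp (-((b - a) * t))
      have h3 : (b - a) * t ≤ |b - a| * t := by gcongr; exact le_abs_self _
      have h4 := Real.exp_pos (-a * t)
      rw [h1]
      nlinarith
    have hkp := key p q
    have hkq := key q p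
    rw [abs_sub_comm] at hkq
    have hp0 : 0 ≤ |q - p| * t * Real.exp (-p * t) := by positivity
    have hq0 : 0 ≤ |q - p| * t * Real.exp (-q * t) := by positivity
    have habs : |Real.exp (-p * t) - Real.exp (-q * t)|
        ≤ |q - p| * t * (Real.exp (-p * t) + Real.exp (-q * t)) := by
      rw [abs_le]
      constructor <;> linarith
    rw [norm_mul, norm_inv, Real.norm_of_nonneg ht.le, Real.norm_eq_abs, inv_mul_le_iff₀ ht]
    refine habs.trans_eq ?_
    simp only [Pi.add_apply]
    ring

theorem integral_inv_mul_exp_sub_exp {p q : ℝ} (hp : 0 < p) (hq : 0 < q) :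
    ∫ t in Ioi (0 : ℝ), t⁻¹ * (Real.exp (-p * t) - Real.exp (-q * t)) = Real.log (q / p) := by
  have hf : Continuous fun x : ℝ => Real.exp (-x) := by fun_prop
  have h := Frullani.integral_Ioi_eq (f := fun x : ℝ => Real.exp (-x)) (L := 1) (R := 0)
    (hf.locallyIntegrable.locallyIntegrableOn _) hp hq
    ((hf.tendsto' 0 1 (by simp)).mono_left nhdsWithin_le_nhds)
    Real.tendsto_exp_neg_atTop_nhds_zero
    (by simpa using integrableOn_inv_mul_exp_sub_exp hp hq)
  simpa using h

/-- The integral representation of `ψ(q) - ψ(p)`, with `ψ` the digamma function, in terms of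
Binet's integrals. -/
theorem integral_exp_sub_exp_div_one_sub_exp {p q : ℝ} (hp : 0 < p) (hq : 0 < q) :
    ∫ t in Ioi (0 : ℝ), (Real.exp (-p * t) - Real.exp (-q * t)) / (1 - Real.exp (-t))
      = 1 / 2 * (1 / p - 1 / q) + Real.log (q / p)
        + 2 * ((∫ y in Ioi (0 : ℝ), y / (p ^ 2 + y ^ 2) * (1 / (Real.exp (2 * Real.pi * y) - 1)))
          - ∫ y in Ioi (0 : ℝ), y / (q ^ 2 + y ^ 2) * (1 / (Real.exp (2 * Real.pi * y) - 1))) := by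
  have hip := integrableOn_exp_mul_Ioi (neg_lt_zero.2 hp) 0
  have hiq := integrableOn_exp_mul_Ioi (neg_lt_zero.2 hq) 0
  have hA : IntegrableOn (fun t : ℝ => 1 / 2 * (Real.exp (-p * t) - Real.exp (-q * t))) (Ioi 0) :=
    (hip.sub hiq).const_mul (1 / 2)
  have hB := integrableOn_inv_mul_exp_sub_exp hp hq
  have hCp := integrableOn_binet_kernel hp
  have hCq := integrableOn_binet_kernel hq
  have hsplit : ∀ t : ℝ, (Real.exp (-p * t) - Real.exp (-q * t)) / (1 - Real.exp (-t))
      = (1 / 2 * (Real.exp (-p * t) - Real.exp (-q * t))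
          + t⁻¹ * (Real.exp (-p * t) - Real.exp (-q * t)))
        + ((1 / (1 - Real.exp (-t)) - 1 / 2 - 1 / t) * Real.exp (-p * t)
          - (1 / (1 - Real.exp (-t)) - 1 / 2 - 1 / t) * Real.exp (-q * t)) := fun t => by ring
  simp_rw [hsplit]
  have hAB := hA.add hB
  have hC := hCp.sub hCq
  simp only [Pi.add_def, Pi.sub_def] at hAB hC
  rw [integral_add hAB hC, integral_add hA hB, integral_sub hCp hCq,
    integral_const_mul, integral_sub hip hiq, integral_inv_mul_exp_sub_exp hp hq,
    integral_binet_kernel hp, integral_binet_kernel hq,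
    integral_exp_mul_Ioi (neg_lt_zero.2 hp), integral_exp_mul_Ioi (neg_lt_zero.2 hq)]
  simp only [mul_zero, Real.exp_zero, neg_div_neg_eq]
  ring

/-- Abel–Plana evaluation of the Laplace transform of `sinh(Mt)/sinh(t/2)`. -/
theorem laplace_sinh_abel_plana (M w : ℝ) (h : |M| < w + 1/2) :
    (∫ t in Set.Ioi (0:ℝ), Real.exp (-w*t) * (Real.sinh (M*t) / Real.sinh (t/2)))
      = M / ((w + 1/2)^2 - M^2) + Real.log ((w + 1/2 + M) / (w + 1/2 - M))
        + 8*M*(w + 1/2) * ∫ y in Set.Ioi (0:ℝ),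
            y / (((w + 1/2 + M)^2 + y^2) * ((w + 1/2 - M)^2 + y^2)) *
              (1 / (Real.exp (2*Real.pi*y) - 1)) := by
  obtain ⟨h1, h2⟩ := abs_lt.1 h
  have hp : 0 < w + 1/2 - M := by linarith
  have hq : 0 < w + 1/2 + M := by linarith
  have hlhs : ∫ t in Set.Ioi (0:ℝ), Real.exp (-w*t) * (Real.sinh (M*t) / Real.sinh (t/2))
      = ∫ t in Ioi (0 : ℝ), (Real.exp (-(w + 1/2 - M) * t) - Real.exp (-(w + 1/2 + M) * t))
        / (1 - Real.exp (-t)) := by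
    refine setIntegral_congr_fun measurableSet_Ioi fun t ht => ?_
    have e1 : 1 - Real.exp (-t) = 2 * Real.exp (-(t / 2)) * Real.sinh (t / 2) := by
      rw [Real.sinh_eq, show -t = -(t / 2) + -(t / 2) by ring, Real.exp_add]
      have := Real.exp_add (-(t / 2)) (t / 2)
      rw [neg_add_cancel, Real.exp_zero] at this
      linear_combination this
    have e2 : Real.exp (-(w + 1/2 - M) * t) - Real.exp (-(w + 1/2 + M) * t)
        = 2 * Real.exp (-(t / 2)) * (Real.exp (-w * t) * Real.sinh (M * t)) := by
      rw [Real.sinh_eq,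
        show -(w + 1/2 - M) * t = -(t / 2) + -w * t + M * t by ring,
        show -(w + 1/2 + M) * t = -(t / 2) + -w * t + -(M * t) by ring]
      simp only [Real.exp_add]
      ring
    have := Real.exp_pos (-(t / 2))
    rw [e1, e2, mul_div_mul_left _ _ (by positivity), mul_div_assoc]
  rw [hlhs, integral_exp_sub_exp_div_one_sub_exp hp hq,
    ← integral_sub (integrableOn_binet_kernel_dual hp) (integrableOn_binet_kernel_dual hq),
    ← integral_const_mul, ← integral_const_mul]
  have hfrac : 1 / 2 * (1 / (w + 1/2 - M) - 1 / (w + 1/2 + M)) = M / ((w + 1/2)^2 - M^2) := by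
    rw [sq_sub_sq, div_sub_div _ _ hp.ne' hq.ne', mul_comm (w + 1/2 - M)]
    ring
  rw [hfrac]
  congr 1
  refine integral_congr_ae (.of_forall fun y => ?_)
  have hp' : (w + 1/2 - M) ^ 2 + y ^ 2 ≠ 0 := by positivity
  have hq' : (w + 1/2 + M) ^ 2 + y ^ 2 ≠ 0 := by positivity
  dsimp only
  rw [← sub_mul, ← mul_assoc, ← mul_assoc]
  congr 1
  rw [div_sub_div _ _ hp' hq', mul_comm ((w + 1/2 - M) ^ 2 + y ^ 2)]
  ring
end

section
/- For every N ∈ ℕ, the integral κ_N := ∫₀^∞ e^{−(N+1/2)t} sinh((N+1/2)t)/sinh(t/2) dt converges and satisfies ln(4N+3) ≤ κ_N ≤ ln(4N+3) + 2. -/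
open MeasureTheory

/-- The integrand of `κ_N` is a finite geometric sum of exponentials. -/
theorem exp_mul_sinh_div_sinh_eq_sum (N : ℕ) {t : ℝ} (ht : 0 < t) :
    Real.exp (-((N : ℝ) + 1/2) * t) *
        (Real.sinh (((N : ℝ) + 1/2) * t) / Real.sinh (t/2)) =
      ∑ k ∈ Finset.range (2 * N + 1), Real.exp (-((k : ℝ) + 1/2) * t) := by
  have hs : Real.sinh (t/2) ≠ 0 := (Real.sinh_pos_iff.2 (by linarith)).ne'
  rw [← mul_div_assoc, div_eq_iff hs]
  have telescope : ∀ n : ℕ,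
      (∑ k ∈ Finset.range n, Real.exp (-((k : ℝ) + 1/2) * t)) * Real.sinh (t/2) =
        (1 - Real.exp (-(n : ℝ) * t)) / 2 := by
    intro n
    induction n with
    | zero => simp
    | succ n ih =>
      rw [Finset.sum_range_succ, add_mul, ih, Real.sinh_eq, mul_div_assoc', mul_sub,
        ← Real.exp_add, ← Real.exp_add]
      push_cast
      ring_nf
  rw [telescope, Real.sinh_eq, mul_div_assoc', mul_sub, ← Real.exp_add, ← Real.exp_add]
  have h0 : -((N : ℝ) + 1/2) * t + ((N : ℝ) + 1/2) * t = 0 := by ring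
  rw [h0, Real.exp_zero]
  push_cast
  ring_nf

theorem log_two_mul_add_one_le_sum (n : ℕ) :
    Real.log (2 * (n : ℝ) + 1) ≤ ∑ k ∈ Finset.range n, ((k : ℝ) + 1/2)⁻¹ := by
  induction n with
  | zero => simp
  | succ n ih =>
    rw [Finset.sum_range_succ]
    have h1 : (0 : ℝ) < 2 * n + 1 := by positivity
    have h3 : (0 : ℝ) < 2 * ((n + 1 : ℕ) : ℝ) + 1 := by positivity
    have h := Real.log_le_sub_one_of_pos (div_pos h3 h1)
    rw [Real.log_div h3.ne' h1.ne'] at h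
    have e : (2 * ((n + 1 : ℕ) : ℝ) + 1) / (2 * n + 1) - 1 = ((n : ℝ) + 1/2)⁻¹ := by
      push_cast
      field_simp
      ring
    linarith

theorem sum_le_log_two_mul_add_one_add_two (n : ℕ) :
    ∑ k ∈ Finset.range (n + 1), ((k : ℝ) + 1/2)⁻¹ ≤ Real.log (2 * (n : ℝ) + 1) + 2 := by
  induction n with
  | zero => norm_num
  | succ n ih =>
    rw [Finset.sum_range_succ]
    have h1 : (0 : ℝ) < 2 * n + 1 := by positivity
    have h3 : (0 : ℝ) < 2 * ((n + 1 : ℕ) : ℝ) + 1 := by positivity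
    have h := Real.log_le_sub_one_of_pos (div_pos h1 h3)
    rw [Real.log_div h1.ne' h3.ne'] at h
    have e : 1 - (2 * (n : ℝ) + 1) / (2 * ((n + 1 : ℕ) : ℝ) + 1) =
        (((n + 1 : ℕ) : ℝ) + 1/2)⁻¹ := by
      push_cast
      field_simp
      ring
    linarith

/-- Asymptotics of `κ_N`: the integral defining `κ_N` converges and
`ln(4N+3) ≤ κ_N ≤ ln(4N+3) + 2`. -/
theorem kappa_asymptotics (N : ℕ) :
    IntegrableOn
      (fun t : ℝ => Real.exp (-((N : ℝ) + 1/2) * t) *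
        (Real.sinh (((N : ℝ) + 1/2) * t) / Real.sinh (t/2))) (Set.Ioi 0) ∧
    Real.log (4*(N : ℝ) + 3)
      ≤ (∫ t in Set.Ioi (0:ℝ), Real.exp (-((N : ℝ) + 1/2) * t) *
          (Real.sinh (((N : ℝ) + 1/2) * t) / Real.sinh (t/2))) ∧
    (∫ t in Set.Ioi (0:ℝ), Real.exp (-((N : ℝ) + 1/2) * t) *
        (Real.sinh (((N : ℝ) + 1/2) * t) / Real.sinh (t/2)))
      ≤ Real.log (4*(N : ℝ) + 3) + 2 := by
  have hneg : ∀ k : ℕ, -((k : ℝ) + 1/2) < 0 := fun k => neg_neg_of_pos (by positivity)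
  have hint : ∀ k ∈ Finset.range (2 * N + 1),
      IntegrableOn (fun t : ℝ => Real.exp (-((k : ℝ) + 1/2) * t)) (Set.Ioi 0) :=
    fun k _ => integrableOn_exp_mul_Ioi (hneg k) 0
  have heq : Set.EqOn
      (fun t : ℝ => Real.exp (-((N : ℝ) + 1/2) * t) *
        (Real.sinh (((N : ℝ) + 1/2) * t) / Real.sinh (t/2)))
      (fun t : ℝ => ∑ k ∈ Finset.range (2 * N + 1), Real.exp (-((k : ℝ) + 1/2) * t))
      (Set.Ioi 0) := fun t ht => exp_mul_sinh_div_sinh_eq_sum N ht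
  have hval : ∫ t in Set.Ioi (0:ℝ), Real.exp (-((N : ℝ) + 1/2) * t) *
      (Real.sinh (((N : ℝ) + 1/2) * t) / Real.sinh (t/2)) =
        ∑ k ∈ Finset.range (2 * N + 1), ((k : ℝ) + 1/2)⁻¹ := by
    rw [setIntegral_congr_fun measurableSet_Ioi heq, integral_finsetSum _ hint]
    refine Finset.sum_congr rfl fun k _ => ?_
    rw [integral_exp_mul_Ioi (hneg k), mul_zero, Real.exp_zero, neg_div_neg_eq, one_div]
  refine ⟨(integrableOn_congr_fun heq measurableSet_Ioi).2 (integrable_finsetSum _ hint), ?_, ?_⟩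
  · rw [hval]
    convert log_two_mul_add_one_le_sum (2 * N + 1) using 2
    push_cast
    ring
  · rw [hval]
    refine (sum_le_log_two_mul_add_one_add_two (2 * N)).trans ?_
    refine add_le_add (Real.log_le_log (by positivity) ?_) le_rfl
    push_cast
    linarith
end
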